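/- (Bound preservation of the IMEX fourth-order scheme for the generalized Allen-Cahn equation with homogeneous Dirichlet boundary condition.) Let β > 0, ε > 0, and let g : ℝ → ℝ (playing the role of F') be differentiable on [−β, β] with g(−β) = g(β) = 0. Assume: h·‖(u,v)‖_∞/μ ≤ 1/3; Δt·μ/h² ≥ 3; and Δt·g'(x) ≤ ε for all x ∈ [−β, β]. Let φⁿ be an array indexed by the grid indices with φⁿ_{i,j} = 0 at boundary indices and φⁿ_{i,j} ∈ [−β, β] at all indices. Then there exists a unique array φ^{n+1} satisfying (Aφ^{n+1})_{i,j} = c·(φⁿ_{i,j} − (Δt/ε)·g(φⁿ_{i,j})) at interior indices and φ^{n+1}_{i,j} = 0 at boundary indices, and every entry of φ^{n+1} lies in [−β, β]. -/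

import Mathlib

/-- The value of a grid array at a pair of natural indices (`0` outside the grid;
inside the grid all index arithmetic of the scheme stays in range). -/
noncomputable def gridVal (nx ny : ℕ) (φ : Fin (nx + 2) → Fin (ny + 2) → ℝ)
    (i j : ℕ) : ℝ :=
  if hi : i < nx + 2 then if hj : j < ny + 2 then φ ⟨i, hi⟩ ⟨j, hj⟩ else 0 else 0

/-- `(i,j)` is a boundary index of the `(nx+2) × (ny+2)` grid. -/
def isBdry (nx ny i j : ℕ) : Prop := i = 0 ∨ i = nx + 1 ∨ j = 0 ∨ j = ny + 1

instance (nx ny i j : ℕ) : Decidable (isBdry nx ny i j) := by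
  unfold isBdry; infer_instance

/-- The scaled 2D fourth-order scheme operator `A = (h²/(μΔt))·L̄` with `c = h²/(μΔt)`:
`(Aφ)ᵢⱼ = c·φᵢⱼ` at boundary indices; at interior indices the fourth-order finite
difference discretization of `c + (h²/μ)(u∂ₓ + v∂_y - μΔ)` obtained from the `Q²`
spectral element method, with the cell-center, x-edge-center, y-edge-center and knot
stencils depending on the parities of `i` and `j`. -/
noncomputable def schemeA2D (nx ny : ℕ) (h μ Δt : ℝ) (u v : ℕ → ℕ → ℝ)
    (φ : Fin (nx + 2) → Fin (ny + 2) → ℝ) (I : Fin (nx + 2)) (J : Fin (ny + 2)) : ℝ :=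
  let c := h ^ 2 / (μ * Δt)
  let i := (I : ℕ)
  let j := (J : ℕ)
  let ψ := gridVal nx ny φ
  if isBdry nx ny i j then c * φ I J
  else if Odd i ∧ Odd j then
    -- cell center
    c * ψ i j + h * u i j / (2 * μ) * (ψ (i + 1) j - ψ (i - 1) j)
      + h * v i j / (2 * μ) * (ψ i (j + 1) - ψ i (j - 1))
      + (-ψ (i - 1) j + 2 * ψ i j - ψ (i + 1) j)
      + (-ψ i (j - 1) + 2 * ψ i j - ψ i (j + 1))
  else if Odd i then
    -- x-edge center (edge parallel to the x-axis): `i` odd, `j` even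
    c * ψ i j + h * u i j / (2 * μ) * (ψ (i + 1) j - ψ (i - 1) j)
      + h * v i j / (4 * μ) * (ψ i (j - 2) - 4 * ψ i (j - 1) + 4 * ψ i (j + 1) - ψ i (j + 2))
      + (-ψ (i - 1) j + 2 * ψ i j - ψ (i + 1) j)
      + (ψ i (j - 2) - 8 * ψ i (j - 1) + 14 * ψ i j - 8 * ψ i (j + 1) + ψ i (j + 2)) / 4
  else if Odd j then
    -- y-edge center (edge parallel to the y-axis): `i` even, `j` odd
    c * ψ i j + h * u i j / (4 * μ) * (ψ (i - 2) j - 4 * ψ (i - 1) j + 4 * ψ (i + 1) j - ψ (i + 2) j)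
      + h * v i j / (2 * μ) * (ψ i (j + 1) - ψ i (j - 1))
      + (ψ (i - 2) j - 8 * ψ (i - 1) j + 14 * ψ i j - 8 * ψ (i + 1) j + ψ (i + 2) j) / 4
      + (-ψ i (j - 1) + 2 * ψ i j - ψ i (j + 1))
  else
    -- interior knot: `i` and `j` both even
    c * ψ i j + h * u i j / (4 * μ) * (ψ (i - 2) j - 4 * ψ (i - 1) j + 4 * ψ (i + 1) j - ψ (i + 2) j)
      + h * v i j / (4 * μ) * (ψ i (j - 2) - 4 * ψ i (j - 1) + 4 * ψ i (j + 1) - ψ i (j + 2))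
      + (ψ (i - 2) j - 8 * ψ (i - 1) j + 14 * ψ i j - 8 * ψ (i + 1) j + ψ (i + 2) j) / 4
      + (ψ i (j - 2) - 8 * ψ i (j - 1) + 14 * ψ i j - 8 * ψ i (j + 1) + ψ i (j + 2)) / 4

theorem gridVal_of_lt {nx ny : ℕ} (φ : Fin (nx + 2) → Fin (ny + 2) → ℝ) {i j : ℕ}
    (hi : i < nx + 2) (hj : j < ny + 2) : gridVal nx ny φ i j = φ ⟨i, hi⟩ ⟨j, hj⟩ := by
  simp [gridVal, hi, hj]

theorem gridVal_add (nx ny : ℕ) (φ ψ : Fin (nx + 2) → Fin (ny + 2) → ℝ) (i j : ℕ) :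
    gridVal nx ny (φ + ψ) i j = gridVal nx ny φ i j + gridVal nx ny ψ i j := by
  unfold gridVal
  split_ifs <;> simp

theorem gridVal_smul (nx ny : ℕ) (a : ℝ) (φ : Fin (nx + 2) → Fin (ny + 2) → ℝ) (i j : ℕ) :
    gridVal nx ny (a • φ) i j = a * gridVal nx ny φ i j := by
  unfold gridVal
  split_ifs <;> simp

theorem gridVal_nonneg {nx ny : ℕ} {φ : Fin (nx + 2) → Fin (ny + 2) → ℝ}
    (hφ : ∀ I J, 0 ≤ φ I J) (i j : ℕ) : 0 ≤ gridVal nx ny φ i j := by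
  unfold gridVal
  split_ifs <;> simp [hφ]

section Scheme

variable (nx ny : ℕ) (h μ Δt : ℝ) (u v : ℕ → ℕ → ℝ)

theorem schemeA2D_add (φ ψ : Fin (nx + 2) → Fin (ny + 2) → ℝ) (I : Fin (nx + 2))
    (J : Fin (ny + 2)) :
    schemeA2D nx ny h μ Δt u v (φ + ψ) I J
      = schemeA2D nx ny h μ Δt u v φ I J + schemeA2D nx ny h μ Δt u v ψ I J := by
  simp only [schemeA2D, gridVal_add, Pi.add_apply]
  split_ifs <;> ring

theorem schemeA2D_smul (a : ℝ) (φ : Fin (nx + 2) → Fin (ny + 2) → ℝ) (I : Fin (nx + 2))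
    (J : Fin (ny + 2)) :
    schemeA2D nx ny h μ Δt u v (a • φ) I J = a * schemeA2D nx ny h μ Δt u v φ I J := by
  simp only [schemeA2D, gridVal_smul, Pi.smul_apply, smul_eq_mul]
  split_ifs <;> ring

variable {nx ny}

/-- The scheme is consistent: the differential part annihilates constants. -/
theorem schemeA2D_const (hnx : Odd nx) (hny : Odd ny) (a : ℝ) (I : Fin (nx + 2))
    (J : Fin (ny + 2)) :
    schemeA2D nx ny h μ Δt u v (fun _ _ ↦ a) I J = h ^ 2 / (μ * Δt) * a := by
  have hI := I.isLt
  have hJ := J.isLt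
  have key : ∀ i j, i < nx + 2 → j < ny + 2 →
      gridVal nx ny (fun _ _ ↦ a) i j = a := fun i j hi hj ↦ gridVal_of_lt _ hi hj
  simp only [schemeA2D]
  split_ifs with h1 h2 h3 h4
  · rfl
  all_goals
    simp only [isBdry, not_or] at h1
    repeat rw [key _ _ (by grind) (by grind)]
    ring

/-- The operator with its boundary rows replaced by those of the identity. -/
noncomputable def dirichletOperator (nx ny : ℕ) (h μ Δt : ℝ) (u v : ℕ → ℕ → ℝ) :
    (Fin (nx + 2) → Fin (ny + 2) → ℝ) →ₗ[ℝ] (Fin (nx + 2) → Fin (ny + 2) → ℝ) where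
  toFun φ I J := if isBdry nx ny I J then φ I J else schemeA2D nx ny h μ Δt u v φ I J
  map_add' φ ψ := by
    ext I J
    simp only [schemeA2D_add, Pi.add_apply]
    split_ifs <;> rfl
  map_smul' a φ := by
    ext I J
    simp only [schemeA2D_smul, Pi.smul_apply, smul_eq_mul, RingHom.id_apply]
    split_ifs <;> rfl

variable {h μ Δt u v}

/-- A nonnegative array on which the operator is positive at every interior index is itself
positive there. Cell centers bound their neighbours, which absorbs the positive off-diagonal
coefficients at edge centers; these in turn absorb those at knots. -/
theorem pos_of_schemeA2D_pos (hnx : Odd nx) (hny : Odd ny)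
    (hc : h ^ 2 / (μ * Δt) ≤ 1 / 3)
    (hu : ∀ i j, 1 ≤ i → i ≤ nx → 1 ≤ j → j ≤ ny → |h * u i j / μ| ≤ 1 / 3)
    (hv : ∀ i j, 1 ≤ i → i ≤ nx → 1 ≤ j → j ≤ ny → |h * v i j / μ| ≤ 1 / 3)
    {ψ : Fin (nx + 2) → Fin (ny + 2) → ℝ} (hψ : ∀ I J, 0 ≤ ψ I J)
    (hA : ∀ (I : Fin (nx + 2)) (J : Fin (ny + 2)), ¬ isBdry nx ny I J →
      0 < schemeA2D nx ny h μ Δt u v ψ I J)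
    (I : Fin (nx + 2)) (J : Fin (ny + 2)) (hIJ : ¬ isBdry nx ny I J) : 0 < ψ I J := by
  have hw2 : ∀ x : ℝ, h * x / (2 * μ) = h * x / μ / 2 := fun x ↦ by
    rw [div_div, mul_comm 2 μ]
  have hw4 : ∀ x : ℝ, h * x / (4 * μ) = h * x / μ / 4 := fun x ↦ by
    rw [div_div, mul_comm 4 μ]
  have hA' := fun i j (h1 : 1 ≤ i) (h2 : i ≤ nx) (h3 : 1 ≤ j) (h4 : j ≤ ny) ↦
    hA ⟨i, by omega⟩ ⟨j, by omega⟩ (by simp only [isBdry]; omega)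
  simp only [schemeA2D, hw2, hw4, Nat.odd_iff] at hA'
  rw [Nat.odd_iff] at hnx hny
  have hf : ∀ i j, 0 ≤ gridVal nx ny ψ i j := gridVal_nonneg hψ
  have hψf : ψ I J = gridVal nx ny ψ I J := (gridVal_of_lt ψ I.isLt J.isLt).symm
  rw [hψf]
  simp only [isBdry, not_or] at hIJ
  have hI := I.isLt
  have hJ := J.isLt
  generalize (I : ℕ) = i at *
  generalize (J : ℕ) = j at *
  generalize gridVal nx ny ψ = f at *
  generalize h ^ 2 / (μ * Δt) = c at *
  have cell : ∀ i j, i % 2 = 1 → j % 2 = 1 → i ≤ nx → j ≤ ny →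
      0 < f i j ∧ f (i - 1) j + f (i + 1) j ≤ 7 * f i j ∧
        f i (j - 1) + f i (j + 1) ≤ 7 * f i j := by
    intro i j hi hj hin hjn
    have hi1 : 1 ≤ i := by omega
    have hj1 : 1 ≤ j := by omega
    have H := hA' i j hi1 hin hj1 hjn
    rw [if_neg (by simp only [isBdry]; omega), if_pos ⟨hi, hj⟩] at H
    obtain ⟨hu1, hu2⟩ := abs_le.1 (hu i j hi1 hin hj1 hjn)
    obtain ⟨hv1, hv2⟩ := abs_le.1 (hv i j hi1 hin hj1 hjn)
    generalize h * u i j / μ = a at *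
    generalize h * v i j / μ = b at *
    have e1 := mul_nonneg (by linarith : 0 ≤ 1 / 3 - a) (hf (i + 1) j)
    have e2 := mul_nonneg (by linarith : 0 ≤ 1 / 3 + a) (hf (i - 1) j)
    have e3 := mul_nonneg (by linarith : 0 ≤ 1 / 3 - b) (hf i (j + 1))
    have e4 := mul_nonneg (by linarith : 0 ≤ 1 / 3 + b) (hf i (j - 1))
    have e5 := mul_nonneg (by linarith : 0 ≤ 1 / 3 - c) (hf i j)
    have := hf (i + 1) j
    have := hf (i - 1) j
    have := hf i (j + 1)
    have := hf i (j - 1)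
    refine ⟨?_, ?_, ?_⟩ <;> linarith
  have xEdge : ∀ i j, i % 2 = 1 → ¬ j % 2 = 1 → 1 ≤ j → i ≤ nx → j ≤ ny →
      0 < f i j ∧ f (i - 1) j + f (i + 1) j ≤ 7 * f i j := by
    intro i j hi hj hj1 hin hjn
    have hi1 : 1 ≤ i := by omega
    have H := hA' i j hi1 hin hj1 hjn
    rw [if_neg (by simp only [isBdry]; omega), if_neg (by omega), if_pos hi] at H
    obtain ⟨hu1, hu2⟩ := abs_le.1 (hu i j hi1 hin hj1 hjn)
    obtain ⟨hv1, hv2⟩ := abs_le.1 (hv i j hi1 hin hj1 hjn)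
    have p := (cell i (j + 1) hi (by omega) hin (by omega)).2.2
    have q := (cell i (j - 1) hi (by omega) hin (by omega)).2.2
    rw [show j + 1 - 1 = j by omega, show j + 1 + 1 = j + 2 by omega] at p
    rw [show j - 1 - 1 = j - 2 by omega, show j - 1 + 1 = j by omega] at q
    generalize h * u i j / μ = a at *
    generalize h * v i j / μ = b at *
    have e1 := mul_nonneg (by linarith : 0 ≤ 1 / 3 - a) (hf (i + 1) j)
    have e2 := mul_nonneg (by linarith : 0 ≤ 1 / 3 + a) (hf (i - 1) j)
    have e3 := mul_nonneg (by linarith : 0 ≤ 1 / 3 + b) (hf i (j + 1))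
    have e4 := mul_nonneg (by linarith : 0 ≤ 1 / 3 - b) (hf i (j - 1))
    have e5 := mul_nonneg (by linarith : 0 ≤ 1 / 3 - c) (hf i j)
    have e6 := mul_le_mul_of_nonneg_left p (by linarith : 0 ≤ 1 - b)
    have e7 := mul_le_mul_of_nonneg_left q (by linarith : 0 ≤ 1 + b)
    have := hf (i + 1) j
    have := hf (i - 1) j
    refine ⟨?_, ?_⟩ <;> linarith
  have yEdge : ∀ i j, ¬ i % 2 = 1 → j % 2 = 1 → 1 ≤ i → i ≤ nx → j ≤ ny →
      0 < f i j ∧ f i (j - 1) + f i (j + 1) ≤ 7 * f i j := by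
    intro i j hi hj hi1 hin hjn
    have hj1 : 1 ≤ j := by omega
    have H := hA' i j hi1 hin hj1 hjn
    rw [if_neg (by simp only [isBdry]; omega), if_neg (by omega), if_neg hi, if_pos hj] at H
    obtain ⟨hu1, hu2⟩ := abs_le.1 (hu i j hi1 hin hj1 hjn)
    obtain ⟨hv1, hv2⟩ := abs_le.1 (hv i j hi1 hin hj1 hjn)
    have p := (cell (i + 1) j (by omega) hj (by omega) hjn).2.1
    have q := (cell (i - 1) j (by omega) hj (by omega) hjn).2.1
    rw [show i + 1 - 1 = i by omega, show i + 1 + 1 = i + 2 by omega] at p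
    rw [show i - 1 - 1 = i - 2 by omega, show i - 1 + 1 = i by omega] at q
    generalize h * u i j / μ = a at *
    generalize h * v i j / μ = b at *
    have e1 := mul_nonneg (by linarith : 0 ≤ 1 / 3 - b) (hf i (j + 1))
    have e2 := mul_nonneg (by linarith : 0 ≤ 1 / 3 + b) (hf i (j - 1))
    have e3 := mul_nonneg (by linarith : 0 ≤ 1 / 3 + a) (hf (i + 1) j)
    have e4 := mul_nonneg (by linarith : 0 ≤ 1 / 3 - a) (hf (i - 1) j)
    have e5 := mul_nonneg (by linarith : 0 ≤ 1 / 3 - c) (hf i j)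
    have e6 := mul_le_mul_of_nonneg_left p (by linarith : 0 ≤ 1 - a)
    have e7 := mul_le_mul_of_nonneg_left q (by linarith : 0 ≤ 1 + a)
    have := hf i (j + 1)
    have := hf i (j - 1)
    refine ⟨?_, ?_⟩ <;> linarith
  by_cases hi : i % 2 = 1 <;> by_cases hj : j % 2 = 1
  · exact (cell i j hi hj (by omega) (by omega)).1
  · exact (xEdge i j hi hj (by omega) (by omega) (by omega)).1
  · exact (yEdge i j hi hj (by omega) (by omega) (by omega)).1
  · have hi1 : 1 ≤ i := by omega
    have hj1 : 1 ≤ j := by omega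
    have hin : i ≤ nx := by omega
    have hjn : j ≤ ny := by omega
    have H := hA' i j hi1 hin hj1 hjn
    rw [if_neg (by simp only [isBdry]; omega), if_neg (by omega), if_neg hi, if_neg hj] at H
    obtain ⟨hu1, hu2⟩ := abs_le.1 (hu i j hi1 hin hj1 hjn)
    obtain ⟨hv1, hv2⟩ := abs_le.1 (hv i j hi1 hin hj1 hjn)
    have p := (xEdge (i + 1) j (by omega) hj hj1 (by omega) hjn).2
    have q := (xEdge (i - 1) j (by omega) hj hj1 (by omega) hjn).2
    have r := (yEdge i (j + 1) hi (by omega) hi1 hin (by omega)).2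
    have s := (yEdge i (j - 1) hi (by omega) hi1 hin (by omega)).2
    rw [show i + 1 - 1 = i by omega, show i + 1 + 1 = i + 2 by omega] at p
    rw [show i - 1 - 1 = i - 2 by omega, show i - 1 + 1 = i by omega] at q
    rw [show j + 1 - 1 = j by omega, show j + 1 + 1 = j + 2 by omega] at r
    rw [show j - 1 - 1 = j - 2 by omega, show j - 1 + 1 = j by omega] at s
    generalize h * u i j / μ = a at *
    generalize h * v i j / μ = b at *
    have e1 := mul_nonneg (by linarith : 0 ≤ 1 / 3 + a) (hf (i + 1) j)
    have e2 := mul_nonneg (by linarith : 0 ≤ 1 / 3 - a) (hf (i - 1) j)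
    have e3 := mul_nonneg (by linarith : 0 ≤ 1 / 3 + b) (hf i (j + 1))
    have e4 := mul_nonneg (by linarith : 0 ≤ 1 / 3 - b) (hf i (j - 1))
    have e5 := mul_nonneg (by linarith : 0 ≤ 1 / 3 - c) (hf i j)
    have e6 := mul_le_mul_of_nonneg_left p (by linarith : 0 ≤ 1 - a)
    have e7 := mul_le_mul_of_nonneg_left q (by linarith : 0 ≤ 1 + a)
    have e8 := mul_le_mul_of_nonneg_left r (by linarith : 0 ≤ 1 - b)
    have e9 := mul_le_mul_of_nonneg_left s (by linarith : 0 ≤ 1 + b)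
    linarith

/-- Discrete minimum principle for the scheme. -/
theorem nonneg_of_schemeA2D_nonneg (hnx : Odd nx) (hny : Odd ny)
    (hc0 : 0 < h ^ 2 / (μ * Δt)) (hc : h ^ 2 / (μ * Δt) ≤ 1 / 3)
    (hu : ∀ i j, 1 ≤ i → i ≤ nx → 1 ≤ j → j ≤ ny → |h * u i j / μ| ≤ 1 / 3)
    (hv : ∀ i j, 1 ≤ i → i ≤ nx → 1 ≤ j → j ≤ ny → |h * v i j / μ| ≤ 1 / 3)
    {φ : Fin (nx + 2) → Fin (ny + 2) → ℝ}
    (hb : ∀ (I : Fin (nx + 2)) (J : Fin (ny + 2)), isBdry nx ny I J → 0 ≤ φ I J)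
    (hA : ∀ (I : Fin (nx + 2)) (J : Fin (ny + 2)), ¬ isBdry nx ny I J →
      0 ≤ schemeA2D nx ny h μ Δt u v φ I J)
    (I : Fin (nx + 2)) (J : Fin (ny + 2)) : 0 ≤ φ I J := by
  obtain ⟨⟨P, Q⟩, hPQ⟩ := Finite.exists_min fun p : Fin (nx + 2) × Fin (ny + 2) ↦ φ p.1 p.2
  refine le_trans ?_ (hPQ (I, J))
  by_contra! hneg
  have hint : ¬ isBdry nx ny P Q := fun hbd ↦ (hb P Q hbd).not_gt hneg
  have hpos := pos_of_schemeA2D_pos hnx hny hc hu hv (ψ := φ + fun _ _ ↦ -φ P Q)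
    (fun K L ↦ by simpa using hPQ (K, L))
    (fun K L hKL ↦ by
      rw [schemeA2D_add, schemeA2D_const _ _ _ _ _ hnx hny]
      exact add_pos_of_nonneg_of_pos (hA K L hKL) (mul_pos hc0 (neg_pos.2 hneg)))
    P Q hint
  simp at hpos

end Scheme

/-- If `k * g' ≤ 1` on `[a, b]` and `g` vanishes at the endpoints, then `x ↦ x - k * g x` maps
`[a, b]` into itself. -/
theorem sub_mul_mem_Icc {a b k : ℝ} {g : ℝ → ℝ}
    (hg : DifferentiableOn ℝ g (Set.Icc a b)) (ha : g a = 0) (hb : g b = 0)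
    (hderiv : ∀ x ∈ Set.Icc a b, k * derivWithin g (Set.Icc a b) x ≤ 1)
    {x : ℝ} (hx : x ∈ Set.Icc a b) : x - k * g x ∈ Set.Icc a b := by
  have hmono : MonotoneOn (fun x ↦ x - k * g x) (Set.Icc a b) := by
    refine monotoneOn_of_hasDerivWithinAt_nonneg (convex_Icc a b)
      (continuousOn_id.sub (continuousOn_const.mul hg.continuousOn))
      (f' := fun x ↦ 1 - k * derivWithin g (Set.Icc a b) x) ?_ ?_
    · intro y hy
      have hy' := interior_subset hy
      exact ((hasDerivWithinAt_id y _).sub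
        ((hg y hy').hasDerivWithinAt.const_mul k)).mono interior_subset
    · intro y hy
      exact sub_nonneg.2 (hderiv y (interior_subset hy))
  have hab := hx.1.trans hx.2
  have h1 := hmono (Set.left_mem_Icc.2 hab) hx hx.1
  have h2 := hmono hx (Set.right_mem_Icc.2 hab) hx.2
  simp only [ha, hb, mul_zero, sub_zero] at h1 h2
  exact ⟨h1, h2⟩

/-- Theorem 4.2 in the paper (bound preservation of the IMEX fourth-order scheme for the
generalized Allen-Cahn equation, homogeneous Dirichlet boundary condition, with the
convenient mesh constraints `h·‖(u,v)‖_∞/μ ≤ 1/3` and `Δt·μ/h² ≥ 3` and the time-step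
constraint `Δt·F'' ≤ ε` on `[-β, β]`): if `φⁿ` vanishes on the boundary and has all
entries in `[-β, β]`, then the IMEX step
`(Aφⁿ⁺¹)ᵢⱼ = c·(φⁿᵢⱼ - (Δt/ε)·g(φⁿᵢⱼ))` at interior indices, `φⁿ⁺¹ = 0` on the boundary,
has a unique solution `φⁿ⁺¹`, and all its entries lie in `[-β, β]`. -/
theorem allenCahn_imex_bound_preserving
    (nx ny : ℕ) (hnx : Odd nx) (hny : Odd ny) (hnx3 : 3 ≤ nx) (hny3 : 3 ≤ ny)
    (h μ Δt : ℝ) (hh : 0 < h) (hμ : 0 < μ) (hΔt : 0 < Δt)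
    (u v : ℕ → ℕ → ℝ) (m : ℝ)
    (hm : IsGreatest {x : ℝ | ∃ i j : ℕ, 1 ≤ i ∧ i ≤ nx ∧ 1 ≤ j ∧ j ≤ ny ∧
      x = max |u i j| |v i j|} m)
    (hmesh : h * m / μ ≤ 1 / 3)
    (hstep : Δt * μ / h ^ 2 ≥ 3)
    (β ε : ℝ) (hβ : 0 < β) (hε : 0 < ε)
    (g : ℝ → ℝ)
    (hdiff : DifferentiableOn ℝ g (Set.Icc (-β) β))
    (hgm : g (-β) = 0) (hgp : g β = 0)
    (hderiv : ∀ x ∈ Set.Icc (-β) β, Δt * derivWithin g (Set.Icc (-β) β) x ≤ ε)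
    (φn : Fin (nx + 2) → Fin (ny + 2) → ℝ)
    (hφnBdry : ∀ (I : Fin (nx + 2)) (J : Fin (ny + 2)),
      isBdry nx ny (I : ℕ) (J : ℕ) → φn I J = 0)
    (hφnBound : ∀ I J, φn I J ∈ Set.Icc (-β) β) :
    (∃! φ' : Fin (nx + 2) → Fin (ny + 2) → ℝ,
        (∀ (I : Fin (nx + 2)) (J : Fin (ny + 2)),
          isBdry nx ny (I : ℕ) (J : ℕ) → φ' I J = 0) ∧
        ∀ (I : Fin (nx + 2)) (J : Fin (ny + 2)), ¬ isBdry nx ny (I : ℕ) (J : ℕ) →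
          schemeA2D nx ny h μ Δt u v φ' I J
            = h ^ 2 / (μ * Δt) * (φn I J - Δt / ε * g (φn I J))) ∧
      ∀ φ' : Fin (nx + 2) → Fin (ny + 2) → ℝ,
        ((∀ (I : Fin (nx + 2)) (J : Fin (ny + 2)),
            isBdry nx ny (I : ℕ) (J : ℕ) → φ' I J = 0) ∧
          ∀ (I : Fin (nx + 2)) (J : Fin (ny + 2)), ¬ isBdry nx ny (I : ℕ) (J : ℕ) →
            schemeA2D nx ny h μ Δt u v φ' I J
              = h ^ 2 / (μ * Δt) * (φn I J - Δt / ε * g (φn I J))) →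
        ∀ I J, φ' I J ∈ Set.Icc (-β) β := by
  have hc0 : 0 < h ^ 2 / (μ * Δt) := by positivity
  have hc : h ^ 2 / (μ * Δt) ≤ 1 / 3 := by
    rw [ge_iff_le, le_div_iff₀ (by positivity)] at hstep
    rw [div_le_div_iff₀ (by positivity) (by norm_num)]
    linarith
  have hmax : ∀ i j, 1 ≤ i → i ≤ nx → 1 ≤ j → j ≤ ny → max |u i j| |v i j| ≤ m :=
    fun i j h1 h2 h3 h4 ↦ hm.2 ⟨i, j, h1, h2, h3, h4, rfl⟩
  have habs : ∀ x : ℝ, |x| ≤ m → |h * x / μ| ≤ 1 / 3 := fun x hx ↦ by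
    rw [abs_div, abs_mul, abs_of_pos hh, abs_of_pos hμ]
    exact le_trans (by gcongr) hmesh
  have hmin := fun φ ↦ nonneg_of_schemeA2D_nonneg (φ := φ) hnx hny hc0 hc
    (fun i j h1 h2 h3 h4 ↦ habs _ ((le_max_left _ _).trans (hmax i j h1 h2 h3 h4)))
    (fun i j h1 h2 h3 h4 ↦ habs _ ((le_max_right _ _).trans (hmax i j h1 h2 h3 h4)))
  have hrhs : ∀ I J, φn I J - Δt / ε * g (φn I J) ∈ Set.Icc (-β) β := fun I J ↦
    sub_mul_mem_Icc hdiff hgm hgp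
      (fun x hx ↦ by rw [div_mul_eq_mul_div, div_le_one hε]; exact hderiv x hx) (hφnBound I J)
  have hinj : Function.Injective (dirichletOperator nx ny h μ Δt u v) := by
    rw [injective_iff_map_eq_zero]
    intro φ hφ
    have hz : ∀ (I : Fin (nx + 2)) (J : Fin (ny + 2)), (if isBdry nx ny (I : ℕ) (J : ℕ) then φ I J
        else schemeA2D nx ny h μ Δt u v φ I J) = 0 := fun I J ↦ congrFun₂ hφ I J
    have hpos := hmin φ
      (fun I J hIJ ↦ by simpa [hIJ] using (hz I J).ge)
      (fun I J hIJ ↦ by simpa [hIJ] using (hz I J).ge)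
    have hneg := hmin ((-1 : ℝ) • φ)
      (fun I J hIJ ↦ by simpa [hIJ] using (hz I J).le)
      (fun I J hIJ ↦ by rw [schemeA2D_smul]; simpa [hIJ] using (hz I J).le)
    ext I J
    exact le_antisymm (by simpa using hneg I J) (hpos I J)
  refine ⟨?_, ?_⟩
  · obtain ⟨φ, hφ⟩ := LinearMap.injective_iff_surjective.1 hinj fun I J ↦
      if isBdry nx ny (I : ℕ) (J : ℕ) then 0
      else h ^ 2 / (μ * Δt) * (φn I J - Δt / ε * g (φn I J))
    refine ⟨φ, ⟨fun I J hIJ ↦ ?_, fun I J hIJ ↦ ?_⟩, fun ψ hψ ↦ hinj ?_⟩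
    · simpa [dirichletOperator, hIJ] using congrFun₂ hφ I J
    · simpa [dirichletOperator, hIJ] using congrFun₂ hφ I J
    · rw [hφ]
      ext I J
      by_cases hIJ : isBdry nx ny (I : ℕ) (J : ℕ)
      · simpa [dirichletOperator, hIJ] using hψ.1 I J hIJ
      · simpa [dirichletOperator, hIJ] using hψ.2 I J hIJ
  · rintro φ ⟨hb, hA⟩ I J
    have hlo := hmin (φ + fun _ _ ↦ β)
      (fun K L hKL ↦ by simp [hb K L hKL, hβ.le])
      (fun K L hKL ↦ by
        rw [schemeA2D_add, schemeA2D_const _ _ _ _ _ hnx hny, hA K L hKL, ← mul_add]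
        exact mul_nonneg hc0.le (by linarith [(hrhs K L).1])) I J
    have hhi := hmin ((-1 : ℝ) • φ + fun _ _ ↦ β)
      (fun K L hKL ↦ by simp [hb K L hKL, hβ.le])
      (fun K L hKL ↦ by
        rw [schemeA2D_add, schemeA2D_smul, schemeA2D_const _ _ _ _ _ hnx hny, hA K L hKL,
          mul_left_comm, ← mul_add]
        exact mul_nonneg hc0.le (by linarith [(hrhs K L).2])) I J
    simp only [Pi.add_apply, Pi.smul_apply, smul_eq_mul] at hlo hhi
    exact ⟨by linarith, by linarith⟩
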